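/- For every natural number s ≥ 1, all Taylor coefficients of positive index of the function u(z) = (1 + s²z)^{1/s} at z = 0 are integers divisible by s. Explicitly, writing (1 + s²z)^{1/s} = 1 + β₁z + β₂z² + … so that β_k = s^{2k} · C(1/s, k), where C(1/s, k) = (1/s)(1/s − 1)⋯(1/s − k + 1)/k! is the generalized binomial coefficient, each β_k for k ≥ 1 is an integer divisible by s. -/

import Mathlib

theorem factorial_dvd_prod_range_sub (a : ℤ) (k : ℕ) :
    (Nat.factorial k : ℤ) ∣ ∏ i ∈ Finset.range k, (a - i) := by
  rw [← descPochhammer_eval_eq_prod_range, Polynomial.eval_eq_smeval,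
    Ring.descPochhammer_eq_factorial_smul_choose, nsmul_eq_mul]
  exact dvd_mul_right _ _

/-- A modulus coprime to `s` sees `∏ (1 - i s)` as a falling factorial of the inverse of `s`,
up to a unit. -/
theorem dvd_prod_one_sub_mul_of_isCoprime {d s : ℤ} {k : ℕ} (hd : d ∣ Nat.factorial k)
    (h : IsCoprime s d) : d ∣ ∏ i ∈ Finset.range k, (1 - (i : ℤ) * s) := by
  obtain ⟨a, b, hab⟩ := h
  have hcong : ∏ i ∈ Finset.range k, (1 - (i : ℤ) * s) ≡
      ∏ i ∈ Finset.range k, s * (a - i) [ZMOD d] := by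
    refine Int.ModEq.prod fun i _ => ?_
    rw [Int.modEq_iff_dvd]
    exact ⟨-b, by linear_combination hab⟩
  rw [hcong.dvd_iff, Finset.prod_mul_distrib]
  exact (hd.trans (factorial_dvd_prod_range_sub a k)).mul_left _

theorem lt_of_prime_pow_dvd_factorial {p n k : ℕ} (hp : p.Prime) (hk : 1 ≤ k)
    (h : p ^ n ∣ Nat.factorial k) : n < k := by
  have : Fact p.Prime := ⟨hp⟩
  have hlt := sub_one_mul_padicValNat_factorial_lt_of_ne_zero p (n := k) (by omega)
  have hn := (padicValNat_dvd_iff_le k.factorial_ne_zero).1 h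
  have hp2 := hp.two_le
  have hle := Nat.le_mul_of_pos_left (padicValNat p (Nat.factorial k)) (by omega : 0 < p - 1)
  omega

theorem factorial_dvd_pow_mul_prod_one_sub_mul (s : ℤ) {k : ℕ} (hk : 1 ≤ k) :
    (Nat.factorial k : ℤ) ∣ s ^ (k - 1) * ∏ i ∈ Finset.range k, (1 - (i : ℤ) * s) := by
  rw [Int.natCast_dvd, Nat.dvd_iff_prime_pow_dvd_dvd]
  intro p n hp hpn
  rw [← Int.natCast_dvd, Nat.cast_pow]
  by_cases hps : (p : ℤ) ∣ s
  · have hn := lt_of_prime_pow_dvd_factorial hp hk hpn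
    exact ((pow_dvd_pow_of_dvd hps n).trans (pow_dvd_pow s (by omega))).mul_right _
  · refine (dvd_prod_one_sub_mul_of_isCoprime (by exact_mod_cast hpn) ?_).mul_left _
    exact (((Nat.prime_iff_prime_int.1 hp).coprime_iff_not_dvd.2 hps).symm).pow_right

/-- For every natural number `s ≥ 1`, all Taylor coefficients of positive index of
`u(z) = (1 + s²z)^{1/s}` at `z = 0` are integers divisible by `s`: for every `k ≥ 1`
the coefficient `β_k = s^{2k} · C(1/s, k)`, where
`C(1/s, k) = (1/s)(1/s − 1)⋯(1/s − k + 1)/k!` is the generalized binomial coefficient,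
equals `s · m` for some integer `m`. -/
theorem taylor_coeff_binomial_integral_div
    (s : ℕ) (hs : 1 ≤ s) (k : ℕ) (hk : 1 ≤ k) :
    ∃ m : ℤ,
      (s : ℚ) ^ (2 * k) *
        ((∏ i ∈ Finset.range k, ((1 : ℚ) / s - i)) / (Nat.factorial k)) = (s : ℚ) * m := by
  obtain ⟨c, hc⟩ := factorial_dvd_pow_mul_prod_one_sub_mul (s : ℤ) hk
  refine ⟨c, ?_⟩
  have hs0 : (s : ℚ) ≠ 0 := by exact_mod_cast (by omega : s ≠ 0)
  have hf : (Nat.factorial k : ℚ) ≠ 0 := by exact_mod_cast k.factorial_ne_zero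
  have hprod : (s : ℚ) ^ k * ∏ i ∈ Finset.range k, ((1 : ℚ) / s - i) =
      ∏ i ∈ Finset.range k, (1 - (i : ℚ) * s) := by
    rw [Finset.pow_eq_prod_const, ← Finset.prod_mul_distrib]
    refine Finset.prod_congr rfl fun i _ => ?_
    field_simp
  have hcQ : (s : ℚ) ^ (k - 1) * ∏ i ∈ Finset.range k, (1 - (i : ℚ) * s) =
      Nat.factorial k * c := by
    exact_mod_cast hc
  have hpow : (s : ℚ) ^ (2 * k) = s * s ^ (k - 1) * s ^ k := by
    rw [← pow_succ', ← pow_add]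
    congr 1
    omega
  rw [← mul_div_assoc, div_eq_iff hf, hpow]
  linear_combination (s : ℚ) * s ^ (k - 1) * hprod + (s : ℚ) * hcQ
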